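/- In any workflow net WN = (P, T, F), every firing sequence contains at most one occurrence of a transition from ▶• (the postset of the initial place), counting all transitions of ▶• together; i.e., there is at most one position of the sequence whose transition belongs to ▶•. Hence every firing sequence of WN satisfies the constraint AtMostOne(▶•). -/

import Mathlib

open Classical

/-- The edge relation of the underlying bipartite graph of a Petri net:
places and transitions are nodes, flow pairs are directed edges. -/
def NetEdge {P T : Type} (Fpt : P → T → Prop) (Ftp : T → P → Prop) :
    (P ⊕ T) → (P ⊕ T) → Prop
  | Sum.inl p, Sum.inr t => Fpt p t
  | Sum.inr t, Sum.inl p => Ftp t p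
  | _, _ => False

/-- A workflow net: a Petri net with flow relation split into its
place-to-transition part `Fpt` and transition-to-place part `Ftp`,
a unique initial place `source` (empty preset), a unique output place `sink`
(empty postset), and every node on a directed path from `source` to `sink`. -/
structure WorkflowNet (P T : Type) where
  Fpt : P → T → Prop
  Ftp : T → P → Prop
  source : P
  sink : P
  source_pre_empty : ∀ t, ¬ Ftp t source
  sink_post_empty : ∀ t, ¬ Fpt sink t
  source_unique : ∀ p, (∀ t, ¬ Ftp t p) → p = source
  sink_unique : ∀ p, (∀ t, ¬ Fpt p t) → p = sink
  on_path : ∀ x : P ⊕ T,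
    Relation.ReflTransGen (NetEdge Fpt Ftp) (Sum.inl source) x ∧
    Relation.ReflTransGen (NetEdge Fpt Ftp) x (Sum.inl sink)

variable {P T : Type}

/-- The preset `•p` of a place: transitions `t` with `(t, p) ∈ F`. -/
def preset (N : WorkflowNet P T) (p : P) : Set T := {t | N.Ftp t p}

/-- The postset `p•` of a place: transitions `t` with `(p, t) ∈ F`. -/
def postset (N : WorkflowNet P T) (p : P) : Set T := {t | N.Fpt p t}

/-- The initial marking: one token on the initial place, none elsewhere. -/
noncomputable def initialMarking (N : WorkflowNet P T) : P → ℕ :=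
  fun p => if p = N.source then 1 else 0

/-- The final marking: one token on the output place, none elsewhere. -/
noncomputable def finalMarking (N : WorkflowNet P T) : P → ℕ :=
  fun p => if p = N.sink then 1 else 0

/-- A marking enables `t` iff every input place of `t` holds a token. -/
def Enables (N : WorkflowNet P T) (M : P → ℕ) (t : T) : Prop :=
  ∀ p, N.Fpt p t → 0 < M p

/-- `Fires N M t M'`: `t` is enabled at `M` and firing it yields `M'`. -/
def Fires (N : WorkflowNet P T) (M : P → ℕ) (t : T) (M' : P → ℕ) : Prop :=
  Enables N M t ∧ ∀ p,
    (N.Fpt p t ∧ ¬ N.Ftp t p → M' p = M p - 1) ∧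
    (N.Ftp t p ∧ ¬ N.Fpt p t → M' p = M p + 1) ∧
    (¬ (N.Fpt p t ∧ ¬ N.Ftp t p) → ¬ (N.Ftp t p ∧ ¬ N.Fpt p t) → M' p = M p)

/-- Successive firing of a finite sequence of transitions from a marking. -/
inductive FiresSeq (N : WorkflowNet P T) : (P → ℕ) → List T → (P → ℕ) → Prop
  | nil (M : P → ℕ) : FiresSeq N M [] M
  | cons {M M' M'' : P → ℕ} {t : T} {σ : List T} :
      Fires N M t M' → FiresSeq N M' σ M'' → FiresSeq N M (t :: σ) M''

/-- A firing sequence: fireable successively from the initial marking. -/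
def FiringSequence (N : WorkflowNet P T) (σ : List T) : Prop :=
  ∃ M, FiresSeq N (initialMarking N) σ M

/-- A reachable marking. -/
def Reachable (N : WorkflowNet P T) (M : P → ℕ) : Prop :=
  ∃ σ, FiresSeq N (initialMarking N) σ M

/-- A run: a firing sequence leading from the initial to the final marking. -/
def IsRun (N : WorkflowNet P T) (σ : List T) : Prop :=
  FiresSeq N (initialMarking N) σ (finalMarking N)

/-- Safety: every reachable marking puts at most one token in each place. -/
def Safe (N : WorkflowNet P T) : Prop :=
  ∀ M, Reachable N M → ∀ p, M p ≤ 1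

/-- Soundness: option to complete, proper completion, no dead transitions. -/
def Sound (N : WorkflowNet P T) : Prop :=
  (∀ M, Reachable N M → ∃ σ, FiresSeq N M σ (finalMarking N)) ∧
  (∀ M, Reachable N M → 0 < M N.sink → M = finalMarking N) ∧
  (∀ t : T, ∃ M, Reachable N M ∧ Enables N M t)

/-- `AtMostOne(A)`: at most one position of the trace carries a symbol of `A`. -/
def AtMostOneC {α : Type} (A : Set α) (σ : List α) : Prop :=
  ∀ i j : Fin σ.length, σ.get i ∈ A → σ.get j ∈ A → i = j

/-- `End(A)`: the trace is nonempty and its last symbol is in `A`. -/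
def EndC {α : Type} (A : Set α) (σ : List α) : Prop :=
  ∃ a ∈ A, σ.getLast? = some a

/-- `AlternatePrecedence(B, A)`: every `A`-position is preceded by a `B`-position
with no `A`-position strictly in between. -/
def AltPrecC {α : Type} (B A : Set α) (σ : List α) : Prop :=
  ∀ i : Fin σ.length, σ.get i ∈ A →
    ∃ j : Fin σ.length, j < i ∧ σ.get j ∈ B ∧
      ∀ k : Fin σ.length, j < k → k < i → σ.get k ∉ A

/-- The Declare constraint that Algorithm 1 generates from place `p`:
`AlternatePrecedence(•p, p•)` if both `•p` and `p•` are nonempty,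
`AtMostOne(p•)` if `•p = ∅`, and `End(•p)` if `p• = ∅`. -/
def PlaceConstraint (N : WorkflowNet P T) (p : P) (σ : List T) : Prop :=
  if preset N p = ∅ then AtMostOneC (postset N p) σ
  else if postset N p = ∅ then EndC (preset N p) σ
  else AltPrecC (preset N p) (postset N p) σ

/-- A model trace of the specification `DS(WN)`: it satisfies the
constraint generated from every place of the net. -/
def ModelTrace (N : WorkflowNet P T) (σ : List T) : Prop :=
  ∀ p : P, PlaceConstraint N p σ

/-- Firing a transition does not add tokens to the source place. -/
theorem Fires.source_le {P T : Type} {N : WorkflowNet P T} {M M' : P → ℕ} {t : T}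
    (h : Fires N M t M') : M' N.source ≤ M N.source := by
  have hs := h.2 N.source
  have ht := N.source_pre_empty t
  by_cases hp : N.Fpt N.source t
  · have := hs.1 ⟨hp, ht⟩
    omega
  · exact (hs.2.2 (fun h => hp h.1) (fun h => ht h.1)).le

/-- Firing a transition of the postset of the source place consumes a token there. -/
theorem Fires.source_lt {P T : Type} {N : WorkflowNet P T} {M M' : P → ℕ} {t : T}
    (h : Fires N M t M') (ht : t ∈ postset N N.source) : M' N.source < M N.source := by
  have hpos := h.1 N.source ht
  have := (h.2 N.source).1 ⟨ht, N.source_pre_empty t⟩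
  omega

theorem FiresSeq.notMem_postset_source {P T : Type} {N : WorkflowNet P T} {M M' : P → ℕ}
    {σ : List T} (h : FiresSeq N M σ M') (hM : M N.source = 0) :
    ∀ t ∈ σ, t ∉ postset N N.source := by
  induction h with
  | nil => simp
  | cons hf _ ih =>
    refine List.forall_mem_cons.2 ⟨fun ht => ?_, ih ?_⟩
    · have := hf.source_lt ht
      omega
    · have := hf.source_le
      omega

theorem FiresSeq.atMostOneC_postset_source {P T : Type} {N : WorkflowNet P T} {M M' : P → ℕ}
    {σ : List T} (h : FiresSeq N M σ M') (hM : M N.source ≤ 1) :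
    AtMostOneC (postset N N.source) σ := by
  induction h with
  | nil => exact fun i => i.elim0
  | cons hf hσ ih =>
    have htail := ih (hf.source_le.trans hM)
    have hnot (ht : _ ∈ postset N N.source) :=
      hσ.notMem_postset_source (by have := hf.source_lt ht; omega)
    intro i j
    refine Fin.cases ?_ (fun i => ?_) i <;> refine Fin.cases ?_ (fun j => ?_) j
    · exact fun _ _ => rfl
    · exact fun h₀ hj => (hnot h₀ _ (List.get_mem _ j) hj).elim
    · exact fun hi h₀ => (hnot h₀ _ (List.get_mem _ i) hi).elim
    · exact fun hi hj => congrArg Fin.succ (htail i j hi hj)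

/-- In any workflow net, every firing sequence contains at most one occurrence
of a transition from `▶•` (counting all transitions of `▶•` together); i.e.,
every firing sequence satisfies `AtMostOne(▶•)`. -/
theorem firingSequence_atMostOne_source_postset {P T : Type} [Finite P] [Finite T]
    (N : WorkflowNet P T) :
    ∀ σ : List T, FiringSequence N σ → AtMostOneC (postset N N.source) σ := by
  rintro σ ⟨M, h⟩
  exact h.atMostOneC_postset_source (by simp [initialMarking])
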